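/- arXiv:1408.1859 — 3 statements merged into one kernel-verified Lean document; each statement's English description precedes it below -/
import Mathlib

section
/- Fix r ≥ 1 and let D be the unique ℚ-linear derivation of ℚ[x,y] satisfying D(x) = xy^r and D(y) = xy^r. Then for every n ≥ 1, D^n(x) = Σ_π x^{asc(π)+1} y^{rn-asc(π)}, where the sum runs over all r-Stirling permutations π of the multiset [n]_r and asc(π) = #{i : 1 ≤ i ≤ rn-1, π_i < π_{i+1}}. -/
open MvPolynomial

/-- The number of ascents of a word `w 0, w 1, …` given as a function on `Fin m`. -/
def wordAscents {m : ℕ} {α : Type*} [LinearOrder α] (w : Fin m → α) : ℕ :=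
  ((List.ofFn w).zip (List.ofFn w).tail).countP fun p => decide (p.1 < p.2)

/-- An `r`-Stirling permutation of the multiset `{1^r, 2^r, …, n^r}`: every value occurs
exactly `r` times, and whenever `j < k < l` and `w j = w l` one has `w k ≥ w j`. -/
def IsRStirlingPerm {r n : ℕ} (w : Fin (r * n) → Fin n) : Prop :=
  (∀ v : Fin n, (Finset.univ.filter fun i => w i = v).card = r) ∧
  (∀ j k l : Fin (r * n), j < k → k < l → w j = w l → w j ≤ w k)

instance {r n : ℕ} : DecidablePred (fun w : Fin (r * n) → Fin n => IsRStirlingPerm w) :=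
  fun w => inferInstanceAs (Decidable
    ((∀ v : Fin n, (Finset.univ.filter fun i => w i = v).card = r) ∧
     (∀ j k l : Fin (r * n), j < k → k < l → w j = w l → w j ≤ w k)))

def lasc (l : List ℕ) : ℕ := (l.zip l.tail).countP fun p => decide (p.1 < p.2)

def insB (r n : ℕ) (l : List ℕ) (i : ℕ) : List ℕ := l.take i ++ (List.replicate r n ++ l.drop i)

def LS (r n : ℕ) (l : List ℕ) : Prop :=
  l.length = r * n ∧ (∀ x ∈ l, x < n) ∧ (∀ v < n, l.count v = r) ∧
    ∀ a b, List.Sublist [a, b, a] l → a ≤ b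

def TS (r : ℕ) : ℕ → Finset (List ℕ)
  | 0 => {[]}
  | n + 1 => (TS r n).biUnion fun l => (Finset.range (l.length + 1)).image (insB r n l)

theorem lasc_nil : lasc [] = 0 := rfl
theorem lasc_one (x : ℕ) : lasc [x] = 0 := rfl
theorem lasc_cons (x y : ℕ) (t : List ℕ) :
    lasc (x :: y :: t) = lasc (y :: t) + if x < y then 1 else 0 := by
  simp [lasc, List.countP_cons]

theorem lasc_le (x : ℕ) (t : List ℕ) : lasc (x :: t) ≤ t.length := by
  induction t generalizing x with
  | nil => simp [lasc_one]
  | cons y t ih =>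
    rw [lasc_cons]
    have := ih y
    simp only [List.length_cons]
    split_ifs <;> omega

theorem lasc_rep (k n : ℕ) (t : List ℕ) (ht : ∀ x ∈ t, x < n) :
    lasc (List.replicate (k + 1) n ++ t) = lasc t := by
  induction k with
  | zero =>
    cases t with
    | nil => rfl
    | cons y t =>
      have := ht y (by simp)
      simp [lasc_cons]; omega
  | succ k ih =>
    rw [← ih, List.replicate_succ, List.replicate_succ, List.cons_append, List.cons_append,
      lasc_cons]
    simp

theorem lasc_sum_aux {M : Type*} [AddCommMonoid M] (k n : ℕ) (x : ℕ) (t : List ℕ) (hx : x < n)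
    (ht : ∀ x ∈ t, x < n) (f : ℕ → M) :
    ∑ i ∈ Finset.range (t.length + 1), f (lasc (x :: insB (k + 1) n t i)) =
      lasc (x :: t) • f (lasc (x :: t)) +
        (t.length + 1 - lasc (x :: t)) • f (lasc (x :: t) + 1) := by
  induction t generalizing x f with
  | nil =>
    simp only [insB, List.length_nil, zero_add, Finset.sum_range_one, List.take_nil,
      List.drop_nil, List.nil_append, lasc_one]
    rw [List.replicate_succ, List.cons_append, lasc_cons, if_pos hx, ← List.cons_append,
      ← List.replicate_succ, lasc_rep _ _ _ (by simp)]
    simp [lasc_nil]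
  | cons y t ih =>
    have hy : y < n := ht y (by simp)
    have ht' : ∀ x ∈ t, x < n := fun z hz => ht z (by simp [hz])
    have hle := lasc_le y t
    rw [Finset.sum_range_succ']
    have h0 : lasc (x :: insB (k + 1) n (y :: t) 0) = lasc (y :: t) + 1 := by
      simp only [insB, List.take_zero, List.drop_zero, List.nil_append]
      rw [List.replicate_succ, List.cons_append, lasc_cons, if_pos hx, ← List.cons_append,
        ← List.replicate_succ, lasc_rep _ _ _ ht]
    have h1 : ∀ i, lasc (x :: insB (k + 1) n (y :: t) (i + 1)) =
        lasc (y :: insB (k + 1) n t i) + if x < y then 1 else 0 := by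
      intro i
      simp only [insB, List.take_succ_cons, List.drop_succ_cons, List.cons_append]
      rw [lasc_cons]
    rw [h0]
    simp only [h1]
    simp only [List.length_cons]
    rw [ih y hy ht' (fun a => f (a + if x < y then 1 else 0)), lasc_cons]
    split_ifs
    · rw [show t.length + 1 + 1 - (lasc (y :: t) + 1) = t.length + 1 - lasc (y :: t) by omega,
        add_smul, one_smul]
      abel
    · rw [show t.length + 1 + 1 - (lasc (y :: t) + 0) = (t.length + 1 - lasc (y :: t)) + 1 by omega,
        add_smul _ 1 (f _), one_smul]
      simp only [add_zero]
      abel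

theorem lasc_sum {M : Type*} [AddCommMonoid M] (k n : ℕ) (t : List ℕ)
    (ht : ∀ x ∈ t, x < n) (f : ℕ → M) :
    ∑ i ∈ Finset.range (t.length + 1), f (lasc (insB (k + 1) n t i)) =
      (lasc t + 1) • f (lasc t) + (t.length - lasc t) • f (lasc t + 1) := by
  cases t with
  | nil =>
    have := lasc_rep k n [] (by simp)
    simp only [List.append_nil] at this
    simp [insB, lasc_nil, this]
  | cons y t =>
    have hy : y < n := ht y (by simp)
    have ht' : ∀ x ∈ t, x < n := fun z hz => ht z (by simp [hz])
    rw [Finset.sum_range_succ']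
    have h0 : lasc (insB (k + 1) n (y :: t) 0) = lasc (y :: t) := by
      simp only [insB, List.take_zero, List.drop_zero, List.nil_append]
      rw [lasc_rep _ _ _ ht]
    have h1 : ∀ i, insB (k + 1) n (y :: t) (i + 1) = y :: insB (k + 1) n t i := by
      intro i
      simp only [insB, List.take_succ_cons, List.drop_succ_cons, List.cons_append]
    rw [h0]
    simp only [h1, List.length_cons]
    rw [lasc_sum_aux k n y t hy ht', add_smul _ 1, one_smul]
    abel

theorem filter_insB (r n : ℕ) (l : List ℕ) (i : ℕ) (hl : ∀ x ∈ l, x < n) :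
    (insB r n l i).filter (fun x => x ≠ n) = l := by
  have h1 : (l.take i ++ l.drop i).filter (fun x => x ≠ n) = l := by
    rw [List.take_append_drop, List.filter_eq_self]
    intro a ha
    simpa using (hl a ha).ne
  rw [List.filter_append] at h1
  unfold insB
  rw [List.filter_append, List.filter_append]
  have h2 : (List.replicate r n).filter (fun x => x ≠ n) = [] := by
    simp
  rw [h2, List.nil_append, h1]

theorem idxOf_insB (k n : ℕ) (l : List ℕ) (i : ℕ) (hl : ∀ x ∈ l, x < n) (hi : i ≤ l.length) :
    (insB (k + 1) n l i).idxOf n = i := by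
  unfold insB
  rw [List.idxOf_append_of_notMem, List.replicate_succ, List.cons_append, List.idxOf_cons_self]
  · simp [hi]
  · intro h
    exact (hl _ (List.mem_of_mem_take h)).false

theorem no_nbn (r n b : ℕ) (A C : List ℕ) (hA : n ∉ A) (hC : n ∉ C)
    (h : List.Sublist [n, b, n] (A ++ (List.replicate r n ++ C))) : b = n := by
  rw [List.sublist_append_iff] at h
  obtain ⟨l1, l2, e, h1, h2⟩ := h
  cases l1 with
  | cons x t =>
    simp only [List.cons_append, List.cons.injEq] at e
    exact absurd (h1.subset (by simp [← e.1])) hA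
  | nil =>
    simp only [List.nil_append] at e
    subst e
    rw [List.sublist_append_iff] at h2
    obtain ⟨l1, l2, e, h1, h2⟩ := h2
    rcases List.eq_nil_or_concat l2 with rfl | ⟨t, x, rfl⟩
    · have : b ∈ l1 := by
        rw [List.append_nil] at e
        simp [← e]
      exact List.eq_of_mem_replicate (h1.subset this)
    · have e' := congrArg List.getLast? e
      simp at e'
      exact absurd (h2.subset (by simp [e'])) hC

theorem LS_insB (r n : ℕ) (l : List ℕ) (i : ℕ) (h : LS r n l) : LS r (n + 1) (insB r n l i) := by
  obtain ⟨h1, h2, h3, h4⟩ := h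
  have hn : n ∉ l := fun h => (h2 n h).false
  have hmem : ∀ x ∈ insB r n l i, x < n + 1 := by
    intro x hx
    simp only [insB, List.mem_append] at hx
    rcases hx with hx | hx | hx
    · have := h2 x (List.mem_of_mem_take hx); omega
    · have := List.eq_of_mem_replicate hx; omega
    · have := h2 x (List.mem_of_mem_drop hx); omega
  refine ⟨?_, hmem, ?_, ?_⟩
  · simp only [insB, List.length_append, List.length_take, List.length_drop,
      List.length_replicate, mul_add, mul_one]
    omega
  · intro v hv
    have hc : (insB r n l i).count v = l.count v + if n = v then r else 0 := by
      conv_rhs => rw [← List.take_append_drop i l]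
      simp only [insB, List.count_append, List.count_replicate, beq_iff_eq]
      omega
    rw [hc]
    split_ifs with hh
    · subst hh
      rw [List.count_eq_zero_of_not_mem hn, zero_add]
    · rw [h3 v (by omega), add_zero]
  · intro a b hab
    by_cases ha : a = n
    · subst ha
      have := no_nbn r a b _ _ (fun h => hn (List.mem_of_mem_take h))
        (fun h => hn (List.mem_of_mem_drop h)) hab
      omega
    · by_cases hb : b = n
      · have := hmem a (hab.subset (by simp))
        omega
      · have := hab.filter (fun x => x ≠ n)
        rw [filter_insB r n l i h2] at this
        apply h4
        simpa [ha, hb] using this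

theorem LS_decomp (r n : ℕ) (l : List ℕ) (h : LS r (n + 1) l) :
    ∃ A C, n ∉ A ∧ n ∉ C ∧ l = A ++ (List.replicate r n ++ C) := by
  obtain ⟨h1, h2, h3, h4⟩ := h
  have hc := h3 n (by omega)
  set A := l.takeWhile (fun x => x ≠ n) with hA
  set B := l.dropWhile (fun x => x ≠ n) with hB
  have hl : l = A ++ B := (List.takeWhile_append_dropWhile).symm
  set R := B.takeWhile (fun x => x = n) with hR
  set C := B.dropWhile (fun x => x = n) with hCC
  have hB' : B = R ++ C := (List.takeWhile_append_dropWhile).symm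
  have hnA : n ∉ A := by
    intro hh
    simpa using List.mem_takeWhile_imp hh
  have hRr : ∀ x ∈ R, x = n := by
    intro x hh
    simpa using List.mem_takeWhile_imp hh
  have hR' : R = List.replicate R.length n := List.eq_replicate_of_mem hRr
  have hnC : n ∉ C := by
    intro hh
    cases hC : C with
    | nil => simp [hC] at hh
    | cons y t =>
      have hy : y ≠ n := by
        have := List.head_dropWhile_not (fun x => decide (x = n)) (l := B) (by rw [← hCC, hC]; simp)
        simp only [← hCC, hC] at this
        exact of_decide_eq_false this
      have hnt : n ∈ t := by
        rw [hC] at hh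
        rcases List.mem_cons.1 hh with h | h
        · exact absurd h.symm hy
        · exact h
      have hnR : n ∈ R := by
        cases hBc : B with
        | nil => rw [hB', hC] at hBc; simp at hBc
        | cons z s =>
          have := List.head_dropWhile_not (fun x => decide (x ≠ n)) (l := l)
            (by rw [← hB, hBc]; simp)
          simp only [← hB, hBc] at this
          have hz : z = n := not_not.1 (of_decide_eq_false this)
          rw [hR, hBc, hz]
          simp
      have hs : List.Sublist [n, y, n] l := by
        rw [hl, hB', hC]
        apply List.Sublist.trans _ (List.sublist_append_right _ _)
        have e1 : List.Sublist [n] R := List.singleton_sublist.2 hnR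
        have e2 : List.Sublist [n] t := List.singleton_sublist.2 hnt
        exact e1.append (e2.cons_cons y)
      have := h4 n y hs
      have := h2 y (by rw [hl, hB', hC]; simp)
      omega
  refine ⟨A, C, hnA, hnC, ?_⟩
  have : R.length = r := by
    rw [hl, hB', hR'] at hc
    simpa [List.count_append, List.count_eq_zero_of_not_mem hnA,
      List.count_eq_zero_of_not_mem hnC] using hc
  rw [← this, ← hR', ← hB', ← hl]

theorem mem_TS (r n : ℕ) (l : List ℕ) : l ∈ TS r n ↔ LS r n l := by
  induction n generalizing l with
  | zero =>
    simp only [TS, Finset.mem_singleton]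
    constructor
    · rintro rfl
      simp [LS]
    · intro h
      simpa using h.1
  | succ n ih =>
    simp only [TS, Finset.mem_biUnion, Finset.mem_image, Finset.mem_range]
    constructor
    · rintro ⟨l, hl, i, hi, rfl⟩
      exact LS_insB _ _ _ _ ((ih l).1 hl)
    · intro h
      obtain ⟨A, C, hA, hC, rfl⟩ := LS_decomp r n l h
      refine ⟨A ++ C, (ih _).2 ?_, A.length, by simp, by simp [insB]⟩
      obtain ⟨h1, h2, h3, h4⟩ := h
      refine ⟨?_, ?_, ?_, ?_⟩
      · simp only [List.length_append, List.length_replicate, mul_add, mul_one] at h1 ⊢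
        omega
      · intro x hx
        have hxn : x ≠ n := by
          rintro rfl
          simp [hA, hC] at hx
        have := h2 x (by simp only [List.mem_append] at hx ⊢; tauto)
        omega
      · intro v hv
        have := h3 v (by omega)
        simpa [List.count_append, List.count_replicate, hv.ne'] using this
      · intro a b hab
        exact h4 a b (hab.trans (List.Sublist.append (List.Sublist.refl _)
          (List.sublist_append_right _ _)))

theorem sum_TS {M : Type*} [AddCommMonoid M] (k n : ℕ) (f : List ℕ → M) :
    ∑ l ∈ TS (k + 1) (n + 1), f l =
      ∑ l ∈ TS (k + 1) n, ∑ i ∈ Finset.range (l.length + 1), f (insB (k + 1) n l i) := by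
  have hlt : ∀ l ∈ TS (k + 1) n, ∀ x ∈ l, x < n := fun l hl => ((mem_TS _ _ _).1 hl).2.1
  rw [TS, Finset.sum_biUnion]
  · apply Finset.sum_congr rfl
    intro l hl
    rw [Finset.sum_image]
    intro i hi j hj hij
    simp only [Finset.coe_range, Set.mem_Iio] at hi hj
    rw [← idxOf_insB k n l i (hlt l hl) (by omega), hij,
      idxOf_insB k n l j (hlt l hl) (by omega)]
  · intro l hl l' hl' hne
    rw [Function.onFun, Finset.disjoint_left]
    intro x hx hx'
    simp only [Finset.mem_image] at hx hx'
    obtain ⟨i, -, rfl⟩ := hx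
    obtain ⟨j, -, hj⟩ := hx'
    apply hne
    rw [← filter_insB (k + 1) n l i (hlt l hl), ← hj, filter_insB (k + 1) n l' j (hlt l' hl')]

theorem D_iter (k : ℕ)
    (D : Derivation ℚ (MvPolynomial (Fin 2) ℚ) (MvPolynomial (Fin 2) ℚ))
    (hx : D (X 0) = X 0 * X 1 ^ (k + 1)) (hy : D (X 1) = X 0 * X 1 ^ (k + 1)) (n : ℕ) :
    (⇑D)^[n] (X 0) =
      ∑ l ∈ TS (k + 1) n, X 0 ^ (lasc l + 1) * X 1 ^ ((k + 1) * n - lasc l) := by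
  induction n with
  | zero => simp [TS, lasc_nil]
  | succ n ih =>
    rw [Function.iterate_succ_apply', ih, map_sum, sum_TS]
    apply Finset.sum_congr rfl
    intro l hl
    have hl' := (mem_TS _ _ _).1 hl
    rw [lasc_sum k n l hl'.2.1 (fun a => (X 0 ^ (a + 1) * X 1 ^ ((k + 1) * (n + 1) - a) :
      MvPolynomial (Fin 2) ℚ))]
    have hle : lasc l ≤ l.length := by
      cases l with
      | nil => simp [lasc_nil]
      | cons x t => have := lasc_le x t; simp; omega
    rw [hl'.1] at hle ⊢
    obtain ⟨m, hm⟩ := Nat.exists_eq_add_of_le hle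
    generalize lasc l = a at *
    have e1 : (k + 1) * n - a = m := by omega
    have e2 : (k + 1) * (n + 1) - a = m + (k + 1) := by rw [mul_add]; omega
    have e3 : (k + 1) * (n + 1) - (a + 1) = m + k := by rw [mul_add]; omega
    rw [e1, e2, e3]
    simp only [Derivation.leibniz, Derivation.leibniz_pow, hx, hy, smul_eq_mul, nsmul_eq_mul]
    cases m with
    | zero => simp; left; ring
    | succ m => simp; ring

theorem count_ofFn' {m n : ℕ} (w : Fin m → Fin n) (v : Fin n) :
    ((List.ofFn w).map Fin.val).count v.val = (Finset.univ.filter fun i => w i = v).card := by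
  rw [List.count_map_of_injective _ _ Fin.val_injective, List.ofFn_eq_map, List.count_eq_countP,
    List.countP_map, List.countP_eq_length_filter]
  rw [← List.toFinset_card_of_nodup ((List.nodup_finRange m).filter _)]
  congr 1
  ext i
  simp

theorem LS_ofFn {r n : ℕ} (w : Fin (r * n) → Fin n) :
    LS r n ((List.ofFn w).map Fin.val) ↔ IsRStirlingPerm w := by
  set L := (List.ofFn w).map Fin.val with hL
  have hlen : L.length = r * n := by simp [hL]
  have hget : ∀ (i : ℕ) (h : i < L.length), L[i] = (w ⟨i, by omega⟩).val := by
    intro i h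
    simp [hL]
  constructor
  · rintro ⟨-, -, h3, h4⟩
    refine ⟨fun v => by rw [← count_ofFn', h3 v v.2], ?_⟩
    intro i j l hij hjl he
    have hs : List.Sublist [(w i).val, (w j).val, (w i).val] L := by
      have := List.map_getElem_sublist (l := L)
        (is := [Fin.cast hlen.symm i, Fin.cast hlen.symm j, Fin.cast hlen.symm l])
        (by simp [hij, hjl, hij.trans hjl])
      simpa [hget, he] using this
    exact h4 _ _ hs
  · rintro ⟨h1, h2⟩
    refine ⟨hlen, ?_, fun v hv => by rw [← h1 ⟨v, hv⟩, ← count_ofFn'], ?_⟩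
    · intro x hx
      simp only [hL, List.mem_map] at hx
      obtain ⟨y, -, rfl⟩ := hx
      exact y.2
    · intro a b hab
      obtain ⟨is, e, hp⟩ := List.sublist_eq_map_getElem hab
      have h3 : is.length = 3 := by simpa using (congrArg List.length e).symm
      obtain ⟨i, j, l, rfl⟩ := List.length_eq_three.1 h3
      · skip
        simp [hget] at e hp
        obtain ⟨ea, eb, ec⟩ := e
        have := h2 (Fin.cast hlen i) (Fin.cast hlen j) (Fin.cast hlen l)
          (by simpa using hp.1.1) (by simpa using hp.2)
          (Fin.ext (by rw [ea] at ec; exact ec))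
        rw [ea, eb]
        exact this

theorem lasc_ofFn {m n : ℕ} (w : Fin m → Fin n) :
    lasc ((List.ofFn w).map Fin.val) = wordAscents w := by
  unfold lasc wordAscents
  rw [← List.map_tail, List.zip_map, List.countP_map]
  rfl

theorem stmt5 (r : ℕ) (hr : 1 ≤ r)
    (D : Derivation ℚ (MvPolynomial (Fin 2) ℚ) (MvPolynomial (Fin 2) ℚ))
    (hx : D (X 0) = X 0 * X 1 ^ r) (hy : D (X 1) = X 0 * X 1 ^ r)
    (n : ℕ) (hn : 1 ≤ n) :
    (⇑D)^[n] (X 0) =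
      ∑ w ∈ Finset.univ.filter (fun w : Fin (r * n) → Fin n => IsRStirlingPerm w),
        X 0 ^ (wordAscents w + 1) * X 1 ^ (r * n - wordAscents w) := by
  obtain ⟨k, rfl⟩ : ∃ k, r = k + 1 := ⟨r - 1, by omega⟩
  rw [D_iter k D hx hy]
  symm
  refine Finset.sum_bij (fun w _ => (List.ofFn w).map Fin.val) ?_ ?_ ?_ ?_
  · intro w hw
    rw [mem_TS, LS_ofFn]
    simpa using hw
  · intro w _ w' _ h
    exact List.ofFn_injective (List.map_injective_iff.2 Fin.val_injective h)
  · intro l hl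
    rw [mem_TS] at hl
    have hw : (List.ofFn (fun i : Fin ((k + 1) * n) =>
        (⟨l[i.val]'(by rw [hl.1]; exact i.2), hl.2.1 _ (List.getElem_mem _)⟩ : Fin n))).map
          Fin.val = l := by
      apply List.ext_getElem
      · simp [hl.1]
      · intro i h1 h2
        simp
    refine ⟨_, ?_, hw⟩
    rw [Finset.mem_filter]
    refine ⟨Finset.mem_univ _, ?_⟩
    rw [← LS_ofFn, hw]
    exact hl
  · intro w _
    rw [lasc_ofFn]
end

section
/- Let D be the unique ℚ-linear derivation of the polynomial ring ℚ[x,y,z] satisfying D(z) = xyz, D(x) = xy and D(y) = xy. Then for every n ≥ 1, D^n(z) = Σ_{k=1}^{n} Σ_{m=k}^{n} C(n,k,m) x^m y^{k+n-m} z, where C(n,k,m) is the number of partitions of [n] into k lists having exactly m ascents. -/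
open MvPolynomial

/-- The number of internal ascents of a list: indices `i` with `l_i < l_{i+1}`. -/
def internalAscents {α : Type*} [LinearOrder α] (l : List α) : ℕ :=
  (l.zip l.tail).countP fun p => decide (p.1 < p.2)

/-- A partition of `[n]` into lists: a finite set of nonempty duplicate-free lists such
that every element of `[n]` belongs to exactly one of the lists. -/
def IsListPartition {n : ℕ} (P : Finset (List (Fin n))) : Prop :=
  (∀ l ∈ P, l ≠ [] ∧ l.Nodup) ∧ (∀ x : Fin n, (P.filter fun l => x ∈ l).card = 1)

/-- The number of ascents of a partition into lists: each list `l` contributes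
`1` plus its number of internal ascents. -/
def listPartitionAscents {n : ℕ} (P : Finset (List (Fin n))) : ℕ :=
  ∑ l ∈ P, (1 + internalAscents l)

/-- `lahC n k m` is the number of partitions of `[n]` into `k` lists with exactly `m` ascents. -/
noncomputable def lahC (n k m : ℕ) : ℕ :=
  Nat.card {P : Finset (List (Fin n)) //
    IsListPartition P ∧ P.card = k ∧ listPartitionAscents P = m}

namespace LahAux

structure IsPart (n : ℕ) (P : Finset (List ℕ)) : Prop where
  ne : ∀ l ∈ P, l ≠ []
  nd : ∀ l ∈ P, l.Nodup
  lt : ∀ l ∈ P, ∀ x ∈ l, x < n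
  ex : ∀ x < n, ∃ l ∈ P, x ∈ l
  un : ∀ l ∈ P, ∀ l' ∈ P, ∀ x, x ∈ l → x ∈ l' → l = l'

def ins (n : ℕ) (P : Finset (List ℕ)) (l : List ℕ) (i : ℕ) : Finset (List ℕ) :=
  insert (l.insertIdx i n) (P.erase l)

def dom (P : Finset (List ℕ)) : Finset ((_ : List ℕ) × ℕ) :=
  (insert [] P).sigma fun l => Finset.range (l.length + 1)

def Part : ℕ → Finset (Finset (List ℕ))
  | 0 => {∅}
  | n + 1 => ((Part n).sigma fun P => dom P).image fun t => ins n t.1 t.2.1 t.2.2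

theorem mem_ii {l : List ℕ} {i n x : ℕ} (hi : i ≤ l.length) :
    x ∈ l.insertIdx i n ↔ x = n ∨ x ∈ l := by
  rw [(List.perm_insertIdx n l hi).mem_iff]; simp

theorem nd_ii {l : List ℕ} {i n : ℕ} (hi : i ≤ l.length) :
    (l.insertIdx i n).Nodup ↔ n ∉ l ∧ l.Nodup := by
  rw [(List.perm_insertIdx n l hi).nodup_iff]; simp

theorem ins_isPart {n : ℕ} {P : Finset (List ℕ)} {l : List ℕ} {i : ℕ} (h : IsPart n P)
    (hl : l ∈ insert [] P) (hi : i ≤ l.length) : IsPart (n + 1) (ins n P l i) := by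
  have hlt : ∀ x ∈ l, x < n := by
    rcases Finset.mem_insert.1 hl with rfl | h'
    · simp
    · exact h.lt _ h'
  have hnd : l.Nodup := by
    rcases Finset.mem_insert.1 hl with rfl | h'
    · simp
    · exact h.nd _ h'
  have hm := fun x => mem_ii (n := n) (x := x) hi
  have hn := (nd_ii (n := n) hi).2 ⟨fun h => lt_irrefl _ (hlt _ h), hnd⟩
  have hun : ∀ l' ∈ P, l' ≠ l → ∀ x, x ∈ l → x ∉ l' := by
    intro l' hl' hne x hx hx'
    rcases Finset.mem_insert.1 hl with rfl | h'
    · simp at hx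
    · exact hne (h.un _ hl' _ h' x hx' hx)
  obtain ⟨h1, h2, h3, h4, h5⟩ := h
  unfold ins
  generalize l.insertIdx i n = L at *
  refine ⟨?_, ?_, ?_, ?_, ?_⟩
  · intro l' hl'
    rcases Finset.mem_insert.1 hl' with rfl | h'
    · intro h0; have := (hm n).2 (Or.inl rfl); simp [h0] at this
    · exact h1 _ (Finset.mem_of_mem_erase h')
  · grind
  · grind
  · intro x hx
    by_cases hxL : x ∈ L
    · exact ⟨L, by simp, hxL⟩
    · rw [hm] at hxL
      obtain ⟨l', hl', hx'⟩ := h4 x (by omega)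
      exact ⟨l', by grind, hx'⟩
  · grind

theorem ins_erase {n : ℕ} {P : Finset (List ℕ)} {l : List ℕ} {i : ℕ} (h : IsPart n P)
    (hl : l ∈ insert [] P) (hi : i ≤ l.length) :
    P = (insert l ((ins n P l i).erase (l.insertIdx i n))).erase [] := by
  have hm := fun x => mem_ii (n := n) (x := x) hi
  have hL : l.insertIdx i n ∉ P := fun h' => lt_irrefl _ (h.lt _ h' n ((hm n).2 (Or.inl rfl)))
  have h1 := h.ne
  unfold ins
  generalize l.insertIdx i n = L at *
  ext x
  grind

theorem ins_inj {n : ℕ} {P P' : Finset (List ℕ)} {l l' : List ℕ} {i i' : ℕ} (h : IsPart n P)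
    (hl : l ∈ insert [] P) (hi : i ≤ l.length) (h' : IsPart n P')
    (hl' : l' ∈ insert [] P') (hi' : i' ≤ l'.length) (he : ins n P l i = ins n P' l' i') :
    P = P' ∧ l = l' ∧ i = i' := by
  have a1 : l.insertIdx i n = l'.insertIdx i' n := by
    refine (ins_isPart h hl hi).un _ (by simp [ins]) _ (by rw [he]; simp [ins]) n
      ((mem_ii hi).2 (Or.inl rfl)) ((mem_ii hi').2 (Or.inl rfl))
  have hlt : n ∉ l := by
    rcases Finset.mem_insert.1 hl with rfl | h'
    · simp
    · exact fun hh => lt_irrefl _ (h.lt _ h' _ hh)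
  have hlt' : n ∉ l' := by
    rcases Finset.mem_insert.1 hl' with rfl | h''
    · simp
    · exact fun hh => lt_irrefl _ (h'.lt _ h'' _ hh)
  have key : ∀ (l : List ℕ) (i : ℕ), i ≤ l.length → n ∉ l → (l.insertIdx i n).erase n = l ∧
      (l.insertIdx i n).idxOf n = i := by
    intro l
    induction l with
    | nil => intro i hi _; simp at hi; subst hi; simp
    | cons b t ih =>
      intro i hi hn
      simp at hn
      cases i with
      | zero => simp
      | succ j =>
        have := ih j (by simpa using hi) hn.2
        have hb : b ≠ n := fun h => hn.1 h.symm
        simp [List.erase_cons, List.idxOf_cons, this, hb]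
  have k1 := key l i hi hlt
  have k2 := key l' i' hi' hlt'
  have e1 : l = l' := by rw [← k1.1, ← k2.1, a1]
  have e2 : i = i' := by rw [← k1.2, ← k2.2, a1]
  refine ⟨?_, e1, e2⟩
  rw [ins_erase h hl hi, ins_erase h' hl' hi', he, a1, e1]

theorem ins_surj {n : ℕ} {Q : Finset (List ℕ)} (h : IsPart (n + 1) Q) :
    ∃ P l i, IsPart n P ∧ l ∈ insert [] P ∧ i ≤ l.length ∧ ins n P l i = Q := by
  obtain ⟨L, hL, hn⟩ := h.ex n (by omega)
  obtain ⟨u, v, rfl⟩ := List.append_of_mem hn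
  have hnd := h.nd _ hL
  have hi : u.length ≤ (u ++ v).length := by simp
  have e : (u ++ v).insertIdx u.length n = u ++ n :: v := by
    clear * -
    induction u with
    | nil => simp
    | cons b t ih => simpa using ih
  rw [← e] at hnd hL
  have hm := fun x => mem_ii (n := n) (x := x) hi
  rw [nd_ii hi] at hnd
  refine ⟨(insert (u ++ v) (Q.erase ((u ++ v).insertIdx u.length n))).erase [], u ++ v, u.length,
    ?_, ?_, hi, ?_⟩
  · obtain ⟨h1, h2, h3, h4, h5⟩ := h
    generalize (u ++ v).insertIdx u.length n = L at *
    generalize u ++ v = l at *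
    refine ⟨?_, ?_, ?_, ?_, ?_⟩
    · grind
    · grind
    · intro l' hl' x hx
      have : x ≠ n := by
        rintro rfl
        grind
      have : x < n + 1 := by grind
      omega
    · intro x hx
      obtain ⟨l', hl', hx'⟩ := h4 x (by omega)
      by_cases hh : l' = L
      · exact ⟨l, by grind, by grind⟩
      · exact ⟨l', by grind, hx'⟩
    · grind
  · grind
  · obtain ⟨h1, h2, h3, h4, h5⟩ := h
    unfold ins
    generalize (u ++ v).insertIdx u.length n = L at *
    generalize u ++ v = l at *
    have hlQ : l ∉ Q := by
      intro hlQ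
      cases l with
      | nil => exact h1 _ hlQ rfl
      | cons b t =>
        have := h5 _ hlQ _ hL b (by simp) (by rw [hm]; simp)
        have := (hm n).2 (Or.inl rfl)
        grind
    ext x
    grind

theorem mem_dom {P : Finset (List ℕ)} {t : (_ : List ℕ) × ℕ} :
    t ∈ dom P ↔ t.1 ∈ insert [] P ∧ t.2 ≤ t.1.length := by
  simp [dom, Nat.lt_succ_iff]

theorem mem_Part {n : ℕ} : ∀ {Q : Finset (List ℕ)}, Q ∈ Part n ↔ IsPart n Q := by
  induction n with
  | zero =>
    intro Q
    simp only [Part, Finset.mem_singleton]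
    constructor
    · rintro rfl; constructor <;> simp
    · intro h
      rw [Finset.eq_empty_iff_forall_notMem]
      intro l hl
      obtain ⟨b, hb⟩ := List.exists_mem_of_ne_nil l (h.ne l hl)
      exact absurd (h.lt l hl b hb) (by simp)
  | succ n ih =>
    intro Q
    simp only [Part, Finset.mem_image, Finset.mem_sigma, mem_dom, ih]
    constructor
    · rintro ⟨⟨P, l, i⟩, ⟨h1, h2, h3⟩, rfl⟩
      exact ins_isPart h1 h2 h3
    · intro h
      obtain ⟨P, l, i, h1, h2, h3, h4⟩ := ins_surj h
      exact ⟨⟨P, l, i⟩, ⟨h1, h2, h3⟩, h4⟩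

theorem sum_Part {M : Type*} [AddCommMonoid M] (n : ℕ) (f : Finset (List ℕ) → M) :
    ∑ Q ∈ Part (n + 1), f Q = ∑ P ∈ Part n, ∑ l ∈ insert [] P,
      ∑ i ∈ Finset.range (l.length + 1), f (ins n P l i) := by
  rw [Part, Finset.sum_image, Finset.sum_sigma]
  · refine Finset.sum_congr rfl fun P _ => ?_
    rw [dom, Finset.sum_sigma]
  · rintro ⟨P, l, i⟩ h ⟨P', l', i'⟩ h' he
    simp only [Finset.coe_sigma, Set.mem_sigma_iff, Finset.mem_coe, mem_dom, mem_Part] at h h'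
    obtain ⟨rfl, rfl, rfl⟩ := ins_inj h.1 h.2.1 h.2.2 h'.1 h'.2.1 h'.2.2 he
    rfl

variable {R : Type*} [CommRing R]

def hw (x y : R) : ℕ → List ℕ → R
  | _, [] => y
  | b, c :: t => (if b < c then x else y) * hw x y c t

def w (x y : R) : List ℕ → R
  | [] => 1
  | b :: t => x * hw x y b t

theorem D_hw [Algebra ℚ R] (D : Derivation ℚ R R) (x y : R) (hx : D x = x * y) (hy : D y = x * y)
    (a : ℕ) (t : List ℕ) : ∀ b, b < a → (∀ c ∈ t, c < a) →
    D (hw x y b t) = ∑ i ∈ Finset.range (t.length + 1), hw x y b (t.insertIdx i a) := by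
  induction t with
  | nil => intro b hb _; simp [hw, hb, hy]
  | cons c t ih =>
    intro b hb hc
    have hca : c < a := hc c (by simp)
    rw [List.length_cons, Finset.sum_range_succ']
    simp only [List.insertIdx_zero, List.insertIdx_succ_cons, hw, hb, if_true, not_lt.2 hca.le,
      if_false, Derivation.leibniz, ih c hca (fun d hd => hc d (by simp [hd])), ← Finset.mul_sum,
      smul_eq_mul]
    split_ifs <;> simp only [hx, hy] <;> ring

theorem D_w [Algebra ℚ R] (D : Derivation ℚ R R) (x y : R) (hx : D x = x * y) (hy : D y = x * y)
    (a : ℕ) (l : List ℕ) (hl : l ≠ []) (hc : ∀ c ∈ l, c < a) :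
    D (w x y l) = ∑ i ∈ Finset.range (l.length + 1), w x y (l.insertIdx i a) := by
  cases l with
  | nil => exact absurd rfl hl
  | cons c t =>
    have hca : c < a := hc c (by simp)
    rw [List.length_cons, Finset.sum_range_succ']
    simp only [List.insertIdx_zero, List.insertIdx_succ_cons, w, hw, not_lt.2 hca.le,
      if_false, Derivation.leibniz, D_hw D x y hx hy a t c hca (fun d hd => hc d (by simp [hd])),
      ← Finset.mul_sum, smul_eq_mul, hx]
    ring

theorem D_prod [Algebra ℚ R] (D : Derivation ℚ R R) {ι : Type*} [DecidableEq ι] (s : Finset ι)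
    (f : ι → R) : D (∏ i ∈ s, f i) = ∑ i ∈ s, D (f i) * ∏ j ∈ s.erase i, f j := by
  induction s using Finset.induction_on with
  | empty => simp
  | insert a s ha ih =>
    rw [Finset.prod_insert ha, Derivation.leibniz, ih, Finset.sum_insert ha,
      Finset.erase_insert ha, smul_eq_mul, smul_eq_mul, Finset.mul_sum, add_comm]
    congr 1
    · ring
    · refine Finset.sum_congr rfl fun i hi => ?_
      have : a ≠ i := by rintro rfl; exact ha hi
      rw [Finset.erase_insert_of_ne this, Finset.prod_insert (by simp [ha])]
      ring

theorem D_iter [Algebra ℚ R] (D : Derivation ℚ R R) (x y z : R) (hx : D x = x * y)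
    (hy : D y = x * y) (hz : D z = x * y * z) (n : ℕ) :
    (⇑D)^[n] z = (∑ P ∈ Part n, ∏ l ∈ P, w x y l) * z := by
  induction n with
  | zero => simp [Part]
  | succ n ih =>
    rw [Function.iterate_succ_apply', ih, Derivation.leibniz, hz, sum_Part, map_sum,
      smul_eq_mul, smul_eq_mul, mul_comm z, ← mul_assoc, ← add_mul, Finset.sum_mul,
      ← Finset.sum_add_distrib]
    congr 1
    refine Finset.sum_congr rfl fun P hP => ?_
    rw [mem_Part] at hP
    have h0 : [] ∉ P := fun h => hP.ne _ h rfl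
    have key : ∀ l ∈ insert [] P, ∀ i ∈ Finset.range (l.length + 1),
        ∏ l ∈ ins n P l i, w x y l = w x y (l.insertIdx i n) * ∏ j ∈ P.erase l, w x y j := by
      intro l hl i hi
      rw [ins, Finset.prod_insert]
      intro h
      exact lt_irrefl _ (hP.lt _ (Finset.mem_of_mem_erase h) n
        ((mem_ii (Nat.lt_succ_iff.1 (Finset.mem_range.1 hi))).2 (Or.inl rfl)))
    rw [Finset.sum_congr rfl fun l hl => Finset.sum_congr rfl (key l hl),
      Finset.sum_insert h0, D_prod]
    congr 1
    · simp [w, hw, Finset.erase_eq_of_notMem h0, mul_comm]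
    · refine Finset.sum_congr rfl fun l hl => ?_
      rw [D_w D x y hx hy n l (hP.ne l hl) (hP.lt l hl), Finset.sum_mul]

theorem sum_len {n : ℕ} : ∀ {P}, IsPart n P → ∑ l ∈ P, l.length = n := by
  induction n with
  | zero =>
    intro P h
    rw [← mem_Part] at h
    simp [Part] at h
    simp [h]
  | succ n ih =>
    intro Q hQ
    obtain ⟨P, l, i, h1, h2, h3, rfl⟩ := ins_surj hQ
    rw [ins, Finset.sum_insert, List.length_insertIdx, if_pos h3]
    · have := ih h1
      rcases Finset.mem_insert.1 h2 with rfl | h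
      · rw [Finset.erase_eq_of_notMem fun h => h1.ne _ h rfl, this]; simp [add_comm]
      · rw [← Finset.add_sum_erase _ _ h] at this
        omega
    · intro h
      exact lt_irrefl _ (h1.lt _ (Finset.mem_of_mem_erase h) n ((mem_ii h3).2 (Or.inl rfl)))

theorem asc_cons {α : Type*} [LinearOrder α] (b c : α) (t : List α) : internalAscents (b :: c :: t)
    = internalAscents (c :: t) + if b < c then 1 else 0 := by
  simp [internalAscents, List.countP_cons]

theorem asc_le (t : List ℕ) : ∀ b, internalAscents (b :: t) ≤ t.length := by
  induction t with
  | nil => intro b; simp [internalAscents]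
  | cons c t ih =>
    intro b
    have := ih c
    rw [asc_cons, List.length_cons]
    split_ifs <;> omega

theorem hw_eq (x y : R) (t : List ℕ) : ∀ b, hw x y b t = x ^ internalAscents (b :: t) *
    y ^ (t.length + 1 - internalAscents (b :: t)) := by
  induction t with
  | nil => intro b; simp [internalAscents, hw]
  | cons c t ih =>
    intro b
    have := asc_le t c
    rw [asc_cons, hw, ih, List.length_cons]
    split_ifs
    · rw [show t.length + 1 + 1 - (internalAscents (c :: t) + 1) =
        t.length + 1 - internalAscents (c :: t) by omega]
      ring
    · rw [show t.length + 1 + 1 - (internalAscents (c :: t) + 0) =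
        t.length + 1 - internalAscents (c :: t) + 1 by omega]
      ring

theorem w_eq (x y : R) (l : List ℕ) (hl : l ≠ []) : w x y l = x ^ (1 + internalAscents l) *
    y ^ (l.length + 1 - (1 + internalAscents l)) ∧ 1 + internalAscents l ≤ l.length := by
  cases l with
  | nil => exact absurd rfl hl
  | cons b t =>
    have := asc_le t b
    rw [w, hw_eq, List.length_cons,
      show t.length + 1 + 1 - (1 + internalAscents (b :: t)) =
        t.length + 1 - internalAscents (b :: t) by omega]
    exact ⟨by ring, by omega⟩

def asc (P : Finset (List ℕ)) : ℕ := ∑ l ∈ P, (1 + internalAscents l)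

theorem W_eq (x y : R) {n : ℕ} {P : Finset (List ℕ)} (h : IsPart n P) :
    ∏ l ∈ P, w x y l = x ^ asc P * y ^ (P.card + n - asc P) ∧ P.card ≤ asc P ∧ asc P ≤ n ∧
      (1 ≤ n → 1 ≤ P.card) := by
  have hs := sum_len h
  have h1 : asc P ≤ n := by
    rw [← hs]; exact Finset.sum_le_sum fun l hl => (w_eq x y l (h.ne l hl)).2
  refine ⟨?_, ?_, h1, ?_⟩
  · rw [Finset.prod_congr rfl fun l hl => (w_eq x y l (h.ne l hl)).1, Finset.prod_mul_distrib,
      Finset.prod_pow_eq_pow_sum, Finset.prod_pow_eq_pow_sum]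
    congr 2
    have e : ∑ l ∈ P, (l.length + 1 - (1 + internalAscents l)) + asc P = P.card + n := by
      rw [asc, ← Finset.sum_add_distrib, ← hs, Finset.card_eq_sum_ones, ← Finset.sum_add_distrib]
      refine Finset.sum_congr rfl fun l hl => ?_
      have := (w_eq x y l (h.ne l hl)).2
      omega
    omega
  · rw [asc, Finset.sum_add_distrib]; simp
  · intro hn
    rw [Nat.one_le_iff_ne_zero, Finset.card_ne_zero, Finset.nonempty_iff_ne_empty]
    rintro rfl
    simp at hs; omega

theorem asc_map {n : ℕ} (l : List (Fin n)) : internalAscents (l.map Fin.val) = internalAscents l := by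
  induction l with
  | nil => rfl
  | cons b t ih =>
    cases t with
    | nil => rfl
    | cons c t =>
      simp only [List.map_cons] at ih ⊢
      rw [asc_cons, asc_cons, ih]
      simp

def emb (n : ℕ) : List (Fin n) ↪ List ℕ := ⟨List.map Fin.val, List.map_injective_iff.2 Fin.val_injective⟩

theorem isPart_map {n : ℕ} (P : Finset (List (Fin n))) :
    IsPart n (P.map (emb n)) ↔ IsListPartition P := by
  have hmem : ∀ (x : Fin n) (l : List (Fin n)), x.val ∈ emb n l ↔ x ∈ l := by
    intro x l
    simp [emb, Fin.val_inj]
  have hnd : ∀ (l : List (Fin n)), (emb n l).Nodup ↔ l.Nodup := fun l =>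
    List.nodup_map_iff Fin.val_injective
  have hlt : ∀ (l : List (Fin n)), ∀ x ∈ emb n l, x < n := by
    intro l x hx
    obtain ⟨y, -, rfl⟩ := List.mem_map.1 hx
    exact y.2
  have hne : ∀ (l : List (Fin n)), emb n l ≠ [] ↔ l ≠ [] := by
    intro l; simp [emb]
  constructor
  · rintro ⟨h1, h2, h3, h4, h5⟩
    refine ⟨fun l hl => ⟨(hne l).1 (h1 _ (Finset.mem_map_of_mem _ hl)),
      (hnd l).1 (h2 _ (Finset.mem_map_of_mem _ hl))⟩, fun x => ?_⟩
    obtain ⟨l', hl', hx⟩ := h4 x x.2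
    obtain ⟨l, hl, rfl⟩ := Finset.mem_map.1 hl'
    rw [hmem] at hx
    rw [Finset.card_eq_one]
    refine ⟨l, ?_⟩
    ext l2
    simp only [Finset.mem_filter, Finset.mem_singleton]
    constructor
    · rintro ⟨h6, h7⟩
      exact (emb n).injective (h5 _ (Finset.mem_map_of_mem _ h6) _ hl' x ((hmem _ _).2 h7)
        ((hmem _ _).2 hx))
    · rintro rfl
      exact ⟨hl, hx⟩
  · rintro ⟨h1, h2⟩
    refine ⟨?_, ?_, ?_, ?_, ?_⟩
    · intro l' hl'
      obtain ⟨l, hl, rfl⟩ := Finset.mem_map.1 hl'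
      exact (hne l).2 (h1 l hl).1
    · intro l' hl'
      obtain ⟨l, hl, rfl⟩ := Finset.mem_map.1 hl'
      exact (hnd l).2 (h1 l hl).2
    · intro l' hl'
      obtain ⟨l, hl, rfl⟩ := Finset.mem_map.1 hl'
      exact hlt l
    · intro x hx
      obtain ⟨l, hl⟩ := Finset.card_eq_one.1 (h2 ⟨x, hx⟩)
      have : l ∈ P.filter fun l => (⟨x, hx⟩ : Fin n) ∈ l := by rw [hl]; simp
      rw [Finset.mem_filter] at this
      exact ⟨emb n l, Finset.mem_map_of_mem _ this.1, (hmem ⟨x, hx⟩ l).2 this.2⟩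
    · intro l1' hl1' l2' hl2' x hx1 hx2
      obtain ⟨l1, hl1, rfl⟩ := Finset.mem_map.1 hl1'
      obtain ⟨l2, hl2, rfl⟩ := Finset.mem_map.1 hl2'
      have hx := hlt l1 x hx1
      have e1 := (hmem ⟨x, hx⟩ l1).1 hx1
      have e2 := (hmem ⟨x, hx⟩ l2).1 hx2
      rw [Finset.card_le_one.1 (h2 ⟨x, hx⟩).le l1 (by simp [hl1, e1]) l2 (by simp [hl2, e2])]

theorem exists_map {n : ℕ} (Q : Finset (List ℕ)) (h : IsPart n Q) :
    ∃ P : Finset (List (Fin n)), P.map (emb n) = Q := by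
  have : (Q : Set (List ℕ)) ⊆ (emb n) '' Set.univ := by
    intro l hl
    rw [Set.image_univ]
    change l ∈ Set.range (List.map Fin.val)
    rw [Set.range_list_map]
    intro x hx
    exact ⟨⟨x, h.lt l hl x hx⟩, rfl⟩
  obtain ⟨P, -, hP⟩ := Finset.subset_set_image_iff.1 this
  exact ⟨P, by rw [Finset.map_eq_image, hP]⟩

theorem asc_mapF {n : ℕ} (P : Finset (List (Fin n))) :
    asc (P.map (emb n)) = listPartitionAscents P := by
  simp [asc, listPartitionAscents, emb, asc_map]

theorem lahC_eq (n k m : ℕ) :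
    lahC n k m = ((Part n).filter fun P => P.card = k ∧ asc P = m).card := by
  rw [lahC, ← Nat.card_eq_finsetCard]
  refine Nat.card_congr (Equiv.ofBijective (fun P => ⟨P.1.map (emb n), ?_⟩) ⟨?_, ?_⟩)
  · rw [Finset.mem_filter, mem_Part, isPart_map, asc_mapF, Finset.card_map]
    exact P.2
  · intro P P' h
    exact Subtype.ext (Finset.map_injective _ (Subtype.ext_iff.1 h))
  · rintro ⟨Q, hQ⟩
    have hQ' := hQ
    rw [Finset.mem_filter, mem_Part] at hQ'
    obtain ⟨P, rfl⟩ := exists_map Q hQ'.1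
    rw [isPart_map, asc_mapF, Finset.card_map] at hQ'
    exact ⟨⟨P, hQ'⟩, rfl⟩

end LahAux

theorem stmt6
    (D : Derivation ℚ (MvPolynomial (Fin 3) ℚ) (MvPolynomial (Fin 3) ℚ))
    (hz : D (X 2) = X 0 * X 1 * X 2)
    (hx : D (X 0) = X 0 * X 1) (hy : D (X 1) = X 0 * X 1)
    (n : ℕ) (hn : 1 ≤ n) :
    (⇑D)^[n] (X 2) =
      ∑ k ∈ Finset.Icc 1 n, ∑ m ∈ Finset.Icc k n,
        (lahC n k m : MvPolynomial (Fin 3) ℚ) * X 0 ^ m * X 1 ^ (k + n - m) * X 2 := by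
  rw [LahAux.D_iter D _ _ _ hx hy hz n, Finset.sum_mul, Finset.sum_sigma']
  rw [← Finset.sum_fiberwise_of_maps_to (s := LahAux.Part n)
    (t := (Finset.Icc 1 n).sigma fun k => Finset.Icc k n)
    (g := fun P => (⟨P.card, LahAux.asc P⟩ : (_ : ℕ) × ℕ))]
  · refine Finset.sum_congr rfl ?_
    rintro ⟨k, m⟩ hkm
    rw [LahAux.lahC_eq, mul_assoc, mul_assoc, ← nsmul_eq_mul, ← Finset.sum_const]
    refine Finset.sum_congr ?_ ?_
    · ext P; simp
    · intro P hP
      simp only [Finset.mem_filter, LahAux.mem_Part] at hP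
      obtain ⟨h1, rfl, rfl⟩ := hP
      rw [(LahAux.W_eq _ _ h1).1, mul_assoc]
  · intro P hP
    rw [LahAux.mem_Part] at hP
    obtain ⟨-, h1, h2, h3⟩ := LahAux.W_eq (1 : ℚ) 1 hP
    have := h3 hn
    simp only [Finset.mem_sigma, Finset.mem_Icc]
    omega
end

section
/- Let K be the field of fractions of ℚ[x,y] and let d be a ℚ-linear derivation of K satisfying d(x) = xy and d(y) = x². Then for every m ≥ 0, d^{2m+1}(x^{-1}) = −x^{-1} y (y² − x²)^m and d^{2m}(x^{-1}) = x^{-1} (y² − x²)^m. -/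
open MvPolynomial

/-- The field of fractions of `ℚ[x,y]`. -/
abbrev FracK : Type := FractionRing (MvPolynomial (Fin 2) ℚ)

/-- The image of the variable `x` in the field of fractions of `ℚ[x,y]`. -/
noncomputable def xK : FracK := algebraMap (MvPolynomial (Fin 2) ℚ) FracK (X 0)

/-- The image of the variable `y` in the field of fractions of `ℚ[x,y]`. -/
noncomputable def yK : FracK := algebraMap (MvPolynomial (Fin 2) ℚ) FracK (X 1)

theorem aux16 {F : Type*} [Field F] (d : Derivation ℤ F F) (x y : F) (h0 : x ≠ 0)
    (hx : d x = x * y) (hy : d y = x ^ 2) (m : ℕ) :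
    (⇑d)^[2 * m + 1] x⁻¹ = -(x⁻¹ * y * (y ^ 2 - x ^ 2) ^ m) ∧
    (⇑d)^[2 * m] x⁻¹ = x⁻¹ * (y ^ 2 - x ^ 2) ^ m := by
  have hi : d x⁻¹ = -(x⁻¹ * y) := by
    rw [Derivation.leibniz_inv, hx, smul_eq_mul]
    field_simp
  have hc : d (y ^ 2 - x ^ 2) = 0 := by
    rw [map_sub, pow_two, pow_two, Derivation.leibniz, Derivation.leibniz, hx, hy]
    simp only [smul_eq_mul]
    ring
  have hcm : ∀ m : ℕ, d ((y ^ 2 - x ^ 2) ^ m) = 0 := by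
    intro m
    rw [Derivation.leibniz_pow, hc]
    simp
  have h1 : ∀ m : ℕ, d (x⁻¹ * (y ^ 2 - x ^ 2) ^ m) = -(x⁻¹ * y * (y ^ 2 - x ^ 2) ^ m) := by
    intro m
    rw [Derivation.leibniz, hcm, hi]
    simp only [smul_eq_mul]
    ring
  have h2 : ∀ m : ℕ, d (-(x⁻¹ * y * (y ^ 2 - x ^ 2) ^ m)) = x⁻¹ * (y ^ 2 - x ^ 2) ^ (m + 1) := by
    intro m
    rw [map_neg, Derivation.leibniz, hcm, Derivation.leibniz, hi, hy]
    simp only [smul_eq_mul]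
    ring
  have he : (⇑d)^[2 * m] x⁻¹ = x⁻¹ * (y ^ 2 - x ^ 2) ^ m := by
    induction m with
    | zero => simp
    | succ k ih =>
      rw [show 2 * (k + 1) = (2 * k + 1) + 1 by ring, Function.iterate_succ_apply',
        Function.iterate_succ_apply', ih, h1, h2]
  exact ⟨by rw [Function.iterate_succ_apply', he, h1], he⟩

theorem aux16' {F : Type*} [Field F] (f : F → F) (hadd : ∀ a b, f (a + b) = f a + f b)
    (hmul : ∀ a b, f (a * b) = a * f b + b * f a) (x y : F) (h0 : x ≠ 0)
    (hx : f x = x * y) (hy : f y = x ^ 2) (m : ℕ) :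
    f^[2 * m + 1] x⁻¹ = -(x⁻¹ * y * (y ^ 2 - x ^ 2) ^ m) ∧
    f^[2 * m] x⁻¹ = x⁻¹ * (y ^ 2 - x ^ 2) ^ m :=
  aux16 (Derivation.mk' (AddMonoidHom.mk' f hadd).toIntLinearMap hmul) x y h0 hx hy m

theorem stmt16 (d : Derivation ℚ FracK FracK)
    (hx : d xK = xK * yK) (hy : d yK = xK ^ 2) (m : ℕ) :
    (⇑d)^[2 * m + 1] xK⁻¹ = -(xK⁻¹ * yK * (yK ^ 2 - xK ^ 2) ^ m) ∧
    (⇑d)^[2 * m] xK⁻¹ = xK⁻¹ * (yK ^ 2 - xK ^ 2) ^ m := by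
  refine aux16' (⇑d) (fun a b => map_add d a b) (fun a b => d.leibniz a b) xK yK ?_ hx hy m
  unfold xK
  intro h
  exact MvPolynomial.X_ne_zero (R := ℚ) (0 : Fin 2)
    ((IsFractionRing.injective (MvPolynomial (Fin 2) ℚ) FracK) (h.trans (map_zero _).symm))
end
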